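/- Let n ≥ 2. There is no cyclic separation relation S on ℚ^n that is invariant under AGL_n(ℚ), i.e., no quaternary relation S on ℚ^n satisfying axioms (s1)–(s4) such that S(σ(α),σ(β);σ(γ),σ(δ)) holds whenever S(α,β;γ,δ) holds and σ ∈ AGL_n(ℚ). -/

import Mathlib

/-- `σ` is an element of `AGL_n(ℚ)`: a permutation of `ℚ^n` of the form
`x ↦ T x + b` with `T` an invertible `ℚ`-linear map and `b ∈ ℚ^n`. -/
def IsAGL (n : ℕ) (σ : Equiv.Perm (Fin n → ℚ)) : Prop :=
  ∃ T : (Fin n → ℚ) ≃ₗ[ℚ] (Fin n → ℚ), ∃ b : Fin n → ℚ, ∀ x, σ x = T x + b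

/-- `S` is a cyclic separation relation on `X`. -/
def IsCyclicSeparation {X : Type*} (S : X → X → X → X → Prop) : Prop :=
  (∀ a b c d : X, S a b c d → S b a c d ∧ S c d a b) ∧
  (∀ a b c d : X, (S a b c d ∧ S a c b d) ↔ (b = c ∨ a = d)) ∧
  (∀ a b c d e : X, S a b c d → S a b c e ∨ S a b d e) ∧
  (∀ a b c d : X, S a b c d ∨ S a c d b ∨ S a d b c)

/-- No cyclic separation relation is invariant under a map that fixes a point `o` and permutes
three points `a`, `b`, `c` cyclically, when `a ≠ b` and `o ≠ c`. -/
theorem IsCyclicSeparation.false_of_three_cycle {X : Type*} {S : X → X → X → X → Prop}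
    (hS : IsCyclicSeparation S) {f : X → X}
    (hf : ∀ x y z w, S x y z w → S (f x) (f y) (f z) (f w)) {o a b c : X}
    (ho : f o = o) (ha : f a = b) (hb : f b = c) (hc : f c = a) (hab : a ≠ b) (hoc : o ≠ c) :
    False := by
  obtain ⟨s1, s2, -, s4⟩ := hS
  have h₁ : S o a b c → S o b c a := fun h => by simpa [ho, ha, hb, hc] using hf _ _ _ _ h
  have h₂ : S o b c a → S o c a b := fun h => by simpa [ho, ha, hb, hc] using hf _ _ _ _ h
  have h₃ : S o c a b → S o a b c := fun h => by simpa [ho, ha, hb, hc] using hf _ _ _ _ h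
  have h : S o a b c := (s4 o a b c).elim id fun h => h.elim (fun h => h₃ (h₂ h)) h₃
  have h' : S o b a c := (s1 _ _ _ _ (s1 _ _ _ _ (s1 _ _ _ _ (h₁ h)).2).1).2
  exact ((s2 o a b c).1 ⟨h, h'⟩).elim hab hoc

/-- The linear automorphism of `ℚ^(m+2)` that sends `e₀ ↦ e₁ ↦ -e₀ - e₁` and fixes the other
standard basis vectors. -/
def planeThreeCycle (m : ℕ) : (Fin (m + 2) → ℚ) ≃ₗ[ℚ] (Fin (m + 2) → ℚ) where
  toFun x i := if i = 0 then -x 1 else if i = 1 then x 0 - x 1 else x i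
  invFun x i := if i = 0 then x 1 - x 0 else if i = 1 then -x 0 else x i
  map_add' x y := by
    ext i
    simp only [Pi.add_apply]
    split_ifs <;> ring
  map_smul' r x := by
    ext i
    simp only [Pi.smul_apply, smul_eq_mul, RingHom.id_apply]
    split_ifs <;> ring
  left_inv x := by
    ext i
    by_cases h0 : i = 0
    · simp [h0]
    · by_cases h1 : i = 1 <;> simp [h0, h1]
  right_inv x := by
    ext i
    by_cases h0 : i = 0
    · simp [h0]
    · by_cases h1 : i = 1 <;> simp [h0, h1]

theorem planeThreeCycle_apply (m : ℕ) (x : Fin (m + 2) → ℚ) (i : Fin (m + 2)) :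
    planeThreeCycle m x i = if i = 0 then -x 1 else if i = 1 then x 0 - x 1 else x i :=
  rfl

/-- For `n ≥ 2`, there is no `AGL_n(ℚ)`-invariant cyclic separation relation on `ℚ^n`. -/
theorem no_agl_invariant_cyclic_separation (n : ℕ) (hn : 2 ≤ n) :
    ¬ ∃ S : (Fin n → ℚ) → (Fin n → ℚ) → (Fin n → ℚ) → (Fin n → ℚ) → Prop,
      IsCyclicSeparation S ∧
      ∀ σ : Equiv.Perm (Fin n → ℚ), IsAGL n σ →
        ∀ a b c d, S a b c d → S (σ a) (σ b) (σ c) (σ d) := by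
  rintro ⟨S, hS, hinv⟩
  obtain ⟨m, rfl⟩ := Nat.exists_eq_add_of_le' hn
  let T := planeThreeCycle m
  have hT : IsAGL (m + 2) T.toEquiv := ⟨T, 0, fun x => (add_zero _).symm⟩
  let e₀ : Fin (m + 2) → ℚ := Pi.single 0 1
  let e₁ : Fin (m + 2) → ℚ := Pi.single 1 1
  have h₀ : T e₀ = e₁ := by
    ext i
    by_cases h0 : i = 0
    · simp [T, e₀, e₁, planeThreeCycle_apply, h0]
    · by_cases h1 : i = 1 <;> simp [T, e₀, e₁, planeThreeCycle_apply, h0, h1]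
  have h₁ : T e₁ = -e₀ - e₁ := by
    ext i
    by_cases h0 : i = 0
    · simp [T, e₀, e₁, planeThreeCycle_apply, h0]
    · by_cases h1 : i = 1 <;> simp [T, e₀, e₁, planeThreeCycle_apply, h0, h1]
  have h₂ : T (-e₀ - e₁) = e₀ := by
    rw [map_sub, map_neg, h₀, h₁]
    abel
  refine hS.false_of_three_cycle (f := T) (hinv _ hT) (map_zero T) h₀ h₁ h₂ (fun h => ?_)
    (fun h => ?_)
  · simpa [e₀, e₁] using congrFun h 0
  · simpa [e₀, e₁] using congrFun h 0
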